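/- Let β ∈ (0,1) and T > 0, and let 𝔉 be a subset of X^β_T satisfying: [A1] sup_{f∈𝔉} |f(0,0)| < ∞; [A2] for every fixed x ∈ ℝ, the family {f(·,x) : f ∈ 𝔉} is equicontinuous on [0,T]; [A3] for every R > 0, lim_{δ↓0} sup_{f∈𝔉} sup_{t∈[0,T], x∈[-R,R]} ∫_{|y|≤δ} |f(t,x+y) − f(t,x)|² |y|^{-1-2β} dy = 0. Then 𝔉 is relatively compact in X^β_T: every sequence in 𝔉 admits a subsequence converging in X^β_T to some element of X^β_T. -/

import Mathlib

open MeasureTheory Set Filter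
open scoped ENNReal

/-- The truncated seminorm
`𝒩_β^{(δ)} f(t,x) = (∫_{|h| ≤ δ} |f(t,x+h) - f(t,x)|² |h|^{-1-2β} dh)^{1/2}`,
applied in the spatial variable. -/
noncomputable def NN (β δ : ℝ) (f : ℝ → ℝ → ℝ) (t x : ℝ) : ℝ≥0∞ :=
  (∫⁻ h in Set.Icc (-δ) δ,
    ENNReal.ofReal (|f t (x + h) - f t x| ^ 2 * |h| ^ (-1 - 2 * β))) ^ (1/2 : ℝ)

/-- Membership in the space `X^β_T`: `f` is continuous on `[0,T] × ℝ`,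
`(t,x) ↦ 𝒩_β^{(1)} f(t,x)` is finite and continuous on `[0,T] × ℝ`, and for every `R > 0`,
`lim_{h → 0} sup_{t ∈ [0,T], x ∈ [-R,R]} 𝒩_β^{(1)}(τ_h f - f)(t,x) = 0`. -/
def memX (β T : ℝ) (f : ℝ → ℝ → ℝ) : Prop :=
  ContinuousOn (fun p : ℝ × ℝ => f p.1 p.2) (Set.Icc (0:ℝ) T ×ˢ (Set.univ : Set ℝ)) ∧
  (∀ t ∈ Set.Icc (0:ℝ) T, ∀ x : ℝ, NN β 1 f t x ≠ ⊤) ∧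
  ContinuousOn (fun p : ℝ × ℝ => (NN β 1 f p.1 p.2).toReal)
    (Set.Icc (0:ℝ) T ×ˢ (Set.univ : Set ℝ)) ∧
  ∀ R > (0:ℝ), Filter.Tendsto
    (fun h : ℝ => ⨆ (t : Set.Icc (0:ℝ) T) (x : Set.Icc (-R) R),
      NN β 1 (fun t' x' => f t' (x' - h) - f t' x') t.1 x.1)
    (nhds 0) (nhds (0 : ℝ≥0∞))

/-- Convergence `f_n → f` in the space `X^β_T`: for every `R > 0`, uniform convergence of
`f_n` to `f` on `[0,T] × [-R,R]` together with
`sup_{t ∈ [0,T], x ∈ [-R,R]} 𝒩_β^{(1)}(f_n - f)(t,x) → 0`. -/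
def convX (β T : ℝ) (fn : ℕ → ℝ → ℝ → ℝ) (f : ℝ → ℝ → ℝ) : Prop :=
  ∀ R > (0:ℝ), ∀ ε > (0:ℝ), ∃ N : ℕ, ∀ n ≥ N,
    ∀ t ∈ Set.Icc (0:ℝ) T, ∀ x ∈ Set.Icc (-R) R,
      |fn n t x - f t x| ≤ ε ∧
      NN β 1 (fun t' x' => fn n t' x' - f t' x') t x ≤ ENNReal.ofReal ε

open scoped Topology

theorem NN_congr {β δ : ℝ} {f g : ℝ → ℝ → ℝ} {t : ℝ} (h : f t = g t) (x : ℝ) :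
    NN β δ f t x = NN β δ g t x := by
  simp only [NN, h]

theorem NN_comp_sub (β δ : ℝ) (f : ℝ → ℝ → ℝ) (t x h : ℝ) :
    NN β δ (fun t' x' => f t' (x' - h)) t x = NN β δ f t (x - h) := by
  simp only [NN, show ∀ y, x + y - h = x - h + y from fun y => by ring]

theorem NN_sub_comm (β δ : ℝ) (f g : ℝ → ℝ → ℝ) (t x : ℝ) :
    NN β δ (fun t' x' => f t' x' - g t' x') t x = NN β δ (fun t' x' => g t' x' - f t' x') t x := by
  have h : ∀ y, |f t (x + y) - g t (x + y) - (f t x - g t x)|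
      = |g t (x + y) - f t (x + y) - (g t x - f t x)| := fun y => by
    rw [← abs_neg]; congr 1; ring
  simp only [NN, h]

theorem measurable_NN_integrand {u : ℝ → ℝ} (hu : Measurable u) (β x : ℝ) :
    Measurable fun h => ENNReal.ofReal (|u (x + h) - u x| ^ 2 * |h| ^ (-1 - 2 * β)) := by
  have : Measurable fun h => u (x + h) := hu.comp (measurable_const_add x)
  fun_prop

theorem NN_add_le {β δ : ℝ} {f g : ℝ → ℝ → ℝ} {t : ℝ} (hf : Measurable (f t))
    (hg : Measurable (g t)) (x : ℝ) :
    NN β δ (fun t' x' => f t' x' + g t' x') t x ≤ NN β δ f t x + NN β δ g t x := by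
  have key : ∀ a h : ℝ, ENNReal.ofReal (|a| ^ 2 * |h| ^ (-1 - 2 * β))
      = ENNReal.ofReal (|a| * |h| ^ ((-1 - 2 * β) / 2)) ^ (2 : ℝ) := fun a h => by
    rw [ENNReal.ofReal_rpow_of_nonneg (by positivity) (by norm_num), Real.rpow_two, mul_pow,
      ← Real.rpow_mul_natCast (abs_nonneg h)]
    norm_num
  have hmeas : ∀ u : ℝ → ℝ, Measurable u → Measurable fun h =>
      ENNReal.ofReal (|u (x + h) - u x| * |h| ^ ((-1 - 2 * β) / 2)) := fun u hu => by
    have : Measurable fun h => u (x + h) := hu.comp (measurable_const_add x)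
    fun_prop
  simp only [NN, key]
  refine le_trans ?_ (ENNReal.lintegral_Lp_add_le (hmeas _ hf).aemeasurable
    (hmeas _ hg).aemeasurable (by norm_num))
  gcongr with h
  rw [Pi.add_apply, ← ENNReal.ofReal_add (by positivity) (by positivity), ← add_mul]
  gcongr
  rw [add_sub_add_comm]
  exact abs_add_le _ _

theorem NN_sub_le {β δ : ℝ} {f g : ℝ → ℝ → ℝ} {t : ℝ} (hf : Measurable (f t))
    (hg : Measurable (g t)) (x : ℝ) :
    NN β δ (fun t' x' => f t' x' - g t' x') t x ≤ NN β δ f t x + NN β δ g t x := by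
  have h := NN_add_le (β := β) (δ := δ) (g := fun t x => -g t x) hf hg.neg x
  have h' := NN_sub_comm β δ 0 g t x
  simp only [Pi.zero_apply, zero_sub, sub_zero] at h'
  rw [h'] at h
  simpa only [sub_eq_add_neg] using h

/-- Fatou's lemma for the truncated seminorm. -/
theorem NN_le_of_tendsto {β δ : ℝ} {f : ℝ → ℝ → ℝ} {g : ℕ → ℝ → ℝ → ℝ} {t x : ℝ} {C : ℝ≥0∞}
    (hg : ∀ n, Measurable (g n t)) (hlim : ∀ y, Tendsto (fun n => g n t y) atTop (𝓝 (f t y)))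
    (hC : ∀ n, NN β δ (g n) t x ≤ C) : NN β δ f t x ≤ C := by
  simp only [NN, one_div, Nat.ofNat_pos, ENNReal.rpow_inv_le_iff] at hC ⊢
  have hint : ∀ h, ENNReal.ofReal (|f t (x + h) - f t x| ^ 2 * |h| ^ (-1 - 2 * β))
      = liminf (fun n => ENNReal.ofReal
        (|g n t (x + h) - g n t x| ^ 2 * |h| ^ (-1 - 2 * β))) atTop := fun h =>
    ((ENNReal.continuous_ofReal.tendsto _).comp
      ((((hlim _).sub (hlim _)).abs.pow 2).mul_const _)).liminf_eq.symm
  simp only [hint]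
  exact (lintegral_liminf_le fun n => measurable_NN_integrand (hg n) β x).trans
    (liminf_le_of_frequently_le' (Frequently.of_forall hC))

/-- Control of `𝒩_β^{(1)}` by the seminorm near `0` and by the supremum away from `0`. -/
theorem NN_one_le {β δ η : ℝ} (hβ : 0 < β) (hδ : 0 < δ) {f : ℝ → ℝ → ℝ} {t x : ℝ}
    (hf : ∀ y ∈ Icc (x - 1) (x + 1), |f t y| ≤ η) :
    NN β 1 f t x ≤ NN β δ f t x
      + ENNReal.ofReal (8 * η ^ 2 * δ ^ (-1 - 2 * β)) ^ (1 / 2 : ℝ) := by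
  have hsub : Icc (-1 : ℝ) 1 ⊆ Icc (-δ) δ ∪ (Icc (-1) 1 \ Icc (-δ) δ) := by
    rw [union_sdiff_self]; exact subset_union_right
  have hfar : ∫⁻ h in Icc (-1 : ℝ) 1 \ Icc (-δ) δ,
      ENNReal.ofReal (|f t (x + h) - f t x| ^ 2 * |h| ^ (-1 - 2 * β))
      ≤ ENNReal.ofReal (8 * η ^ 2 * δ ^ (-1 - 2 * β)) := by
    calc _ ≤ ∫⁻ _ in Icc (-1 : ℝ) 1 \ Icc (-δ) δ,
          ENNReal.ofReal (4 * η ^ 2 * δ ^ (-1 - 2 * β)) := by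
          refine setLIntegral_mono' (measurableSet_Icc.diff measurableSet_Icc) fun h hh => ?_
          obtain ⟨⟨h1, h2⟩, h3⟩ := hh
          rw [mem_Icc, ← abs_le, not_le] at h3
          have ha := hf (x + h) ⟨by linarith, by linarith⟩
          have hb := hf x ⟨by linarith, by linarith⟩
          have hab : |f t (x + h) - f t x| ≤ 2 * η := (abs_sub _ _).trans (by linarith)
          have hpow : |h| ^ (-1 - 2 * β) ≤ δ ^ (-1 - 2 * β) :=
            Real.rpow_le_rpow_of_nonpos hδ h3.le (by linarith)
          refine ENNReal.ofReal_le_ofReal ?_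
          calc _ ≤ (2 * η) ^ 2 * δ ^ (-1 - 2 * β) := by gcongr
            _ = _ := by ring
      _ ≤ ∫⁻ _ in Icc (-1 : ℝ) 1, ENNReal.ofReal (4 * η ^ 2 * δ ^ (-1 - 2 * β)) :=
          lintegral_mono_set sdiff_subset
      _ = _ := by
          rw [setLIntegral_const, Real.volume_Icc, ← ENNReal.ofReal_mul (by positivity)]
          congr 1; ring
  calc NN β 1 f t x ≤ (_ + _) ^ (1 / 2 : ℝ) :=
        ENNReal.rpow_le_rpow ((lintegral_mono_set hsub).trans (lintegral_union_le _ _ _))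
          (by norm_num)
    _ ≤ _ := ENNReal.rpow_add_le_add_rpow _ _ (by norm_num) (by norm_num)
    _ ≤ _ := by unfold NN; gcongr

theorem setLIntegral_sq_le {β δ r : ℝ} (hβ : 0 < β) (hr : 0 < r) (hrδ : r ≤ δ) (u : ℝ → ℝ)
    {x : ℝ} {s : Set ℝ} (hs : MeasurableSet s) (hsr : s ⊆ Icc (-r) r) (h0 : (0 : ℝ) ∉ s) :
    ∫⁻ y in s, ENNReal.ofReal (|u (x + y) - u x| ^ 2) ≤
      ENNReal.ofReal (r ^ (1 + 2 * β)) * ∫⁻ y in Icc (-δ) δ,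
        ENNReal.ofReal (|u (x + y) - u x| ^ 2 * |y| ^ (-1 - 2 * β)) := by
  rw [← lintegral_const_mul' _ _ ENNReal.ofReal_ne_top]
  refine (setLIntegral_mono' hs fun y hy => ?_).trans
    (lintegral_mono_set (hsr.trans (Icc_subset_Icc (neg_le_neg hrδ) hrδ)))
  have hy0 : 0 < |y| := abs_pos.2 fun h => h0 (h ▸ hy)
  have hyr : |y| ≤ r := abs_le.2 (hsr hy)
  rw [← ENNReal.ofReal_mul (by positivity)]
  refine ENNReal.ofReal_le_ofReal ?_
  have h1 : 1 ≤ r ^ (1 + 2 * β) * |y| ^ (-1 - 2 * β) := by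
    rw [show -1 - 2 * β = -(1 + 2 * β) by ring, Real.rpow_neg hy0.le, ← div_eq_mul_inv,
      one_le_div (by positivity)]
    gcongr
  calc |u (x + y) - u x| ^ 2 = |u (x + y) - u x| ^ 2 * 1 := (mul_one _).symm
    _ ≤ |u (x + y) - u x| ^ 2 * (r ^ (1 + 2 * β) * |y| ^ (-1 - 2 * β)) := by gcongr
    _ = _ := by ring

/-- Hölder estimate: a uniform bound on the local seminorm controls increments. -/
theorem ofReal_sq_sub_le {β δ a b : ℝ} (hβ : 0 < β) (hab : a < b) (hδ : b - a ≤ δ)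
    {u : ℝ → ℝ} (hu : Measurable u) {K : ℝ≥0∞}
    (ha : ∫⁻ y in Icc (-δ) δ, ENNReal.ofReal (|u (a + y) - u a| ^ 2 * |y| ^ (-1 - 2 * β)) ≤ K)
    (hb : ∫⁻ y in Icc (-δ) δ, ENNReal.ofReal (|u (b + y) - u b| ^ 2 * |y| ^ (-1 - 2 * β)) ≤ K) :
    ENNReal.ofReal (|u b - u a| ^ 2) ≤ 4 * K * ENNReal.ofReal ((b - a) ^ (2 * β)) := by
  have hr : 0 < b - a := sub_pos.2 hab
  have hA := (setLIntegral_sq_le hβ hr hδ u (x := a) (s := Ioo 0 (b - a)) measurableSet_Ioo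
    (fun y hy => ⟨by linarith [hy.1], hy.2.le⟩) (by simp)).trans (mul_le_mul_right ha _)
  have hB := (setLIntegral_sq_le hβ hr hδ u (x := b) (s := Ioo (-(b - a)) 0) measurableSet_Ioo
    (fun y hy => ⟨hy.1.le, by linarith [hy.2]⟩) (by simp)).trans (mul_le_mul_right hb _)
  have hshift : ∫⁻ y in Ioo (-(b - a)) 0, ENNReal.ofReal (|u (b + y) - u b| ^ 2)
      = ∫⁻ y in Ioo 0 (b - a), ENNReal.ofReal (|u (a + y) - u b| ^ 2) := by
    have h := (measurePreserving_add_right volume (b - a)).setLIntegral_comp_preimage_emb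
      (measurableEmbedding_addRight (b - a))
      (fun y => ENNReal.ofReal (|u (a + y) - u b| ^ 2)) (Ioo 0 (b - a))
    rw [← h, preimage_add_const_Ioo]
    simp [show ∀ y, a + (y + (b - a)) = b + y from fun y => by ring]
  rw [hshift] at hB
  have hmeas : Measurable fun y => u (a + y) := hu.comp (measurable_const_add a)
  have hmain : ENNReal.ofReal (|u b - u a| ^ 2) * ENNReal.ofReal (b - a) ≤
      4 * K * ENNReal.ofReal ((b - a) ^ (2 * β)) * ENNReal.ofReal (b - a) := by
    calc ENNReal.ofReal (|u b - u a| ^ 2) * ENNReal.ofReal (b - a)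
        = ∫⁻ _ in Ioo 0 (b - a), ENNReal.ofReal (|u b - u a| ^ 2) := by
          rw [setLIntegral_const, Real.volume_Ioo, sub_zero]
      _ ≤ ∫⁻ y in Ioo 0 (b - a), 2 * (ENNReal.ofReal (|u (a + y) - u a| ^ 2)
            + ENNReal.ofReal (|u (a + y) - u b| ^ 2)) := by
          refine lintegral_mono fun y => ?_
          rw [← ENNReal.ofReal_add (by positivity) (by positivity), ← ENNReal.ofReal_ofNat,
            ← ENNReal.ofReal_mul (by norm_num)]
          refine ENNReal.ofReal_le_ofReal ?_
          simp only [sq_abs]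
          nlinarith [sq_nonneg ((u (a + y) - u a) + (u (a + y) - u b))]
      _ = 2 * ((∫⁻ y in Ioo 0 (b - a), ENNReal.ofReal (|u (a + y) - u a| ^ 2))
            + ∫⁻ y in Ioo 0 (b - a), ENNReal.ofReal (|u (a + y) - u b| ^ 2)) := by
          rw [lintegral_const_mul' _ _ (by simp), lintegral_add_left (by fun_prop)]
      _ ≤ 2 * (ENNReal.ofReal ((b - a) ^ (1 + 2 * β)) * K
            + ENNReal.ofReal ((b - a) ^ (1 + 2 * β)) * K) := by gcongr
      _ = _ := by
          rw [add_comm 1 (2 * β), Real.rpow_add_one hr.ne', ENNReal.ofReal_mul (by positivity)]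
          ring
  exact (ENNReal.mul_le_mul_iff_left (by simpa using hab) ENNReal.ofReal_ne_top).1 hmain

theorem abs_sub_le_two_mul_rpow {β δ x y : ℝ} (hβ : 0 < β) (hδ : |y - x| ≤ δ)
    {u : ℝ → ℝ} (hu : Measurable u)
    (hx : ∫⁻ h in Icc (-δ) δ, ENNReal.ofReal (|u (x + h) - u x| ^ 2 * |h| ^ (-1 - 2 * β)) ≤ 1)
    (hy : ∫⁻ h in Icc (-δ) δ, ENNReal.ofReal (|u (y + h) - u y| ^ 2 * |h| ^ (-1 - 2 * β)) ≤ 1) :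
    |u y - u x| ≤ 2 * |y - x| ^ β := by
  wlog hxy : x ≤ y generalizing x y
  · rw [abs_sub_comm, abs_sub_comm y]
    exact this (by rwa [abs_sub_comm]) hy hx (le_of_not_ge hxy)
  obtain rfl | hlt := hxy.eq_or_lt
  · simp [Real.zero_rpow hβ.ne']
  have hr : 0 < y - x := sub_pos.2 hlt
  rw [abs_of_pos hr] at hδ ⊢
  have h := ofReal_sq_sub_le hβ hlt hδ hu hx hy
  rw [mul_one, ← ENNReal.ofReal_ofNat, ← ENNReal.ofReal_mul (by norm_num),
    ENNReal.ofReal_le_ofReal_iff (by positivity), mul_comm 2 β, Real.rpow_mul hr.le,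
    Real.rpow_two] at h
  refine abs_le_of_sq_le_sq' (a := |u y - u x|) ?_ (by positivity) |>.2
  linarith [mul_pow 2 ((y - x) ^ β) 2]

/-- Sequential **Arzelà-Ascoli theorem** on a connected σ-compact space: an equicontinuous sequence
bounded at one point has a subsequence converging uniformly on compact sets. -/
theorem exists_subseq_tendsto_of_equicontinuous {X : Type*} [TopologicalSpace X]
    [WeaklyLocallyCompactSpace X] [SigmaCompactSpace X] [PreconnectedSpace X] (G : ℕ → C(X, ℝ))
    (hG : Equicontinuous fun n => (G n : X → ℝ)) (x₀ : X) (M : ℝ) (hM : ∀ n, |G n x₀| ≤ M) :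
    ∃ (g : C(X, ℝ)) (φ : ℕ → ℕ), StrictMono φ ∧ Tendsto (G ∘ φ) atTop (𝓝 g) := by
  have hnear : ∀ x, ∀ᶠ y in 𝓝 x, ∀ n, |G n x - G n y| < 1 := fun x =>
    hG x _ (Metric.dist_mem_uniformity one_pos)
  have hclopen : IsClopen {x | ∃ C, ∀ n, |G n x| ≤ C} := by
    refine ⟨⟨isOpen_iff_mem_nhds.2 fun x hx => ?_⟩, isOpen_iff_mem_nhds.2 fun x hx => ?_⟩
    · filter_upwards [hnear x] with y hy
      rintro ⟨C, hC⟩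
      exact hx ⟨C + 1, fun n => by
        linarith [abs_sub_abs_le_abs_sub (G n x) (G n y), hC n, hy n]⟩
    · obtain ⟨C, hC⟩ := hx
      filter_upwards [hnear x] with y hy
      exact ⟨C + 1, fun n => by
        linarith [abs_sub_abs_le_abs_sub (G n y) (G n x), hC n, hy n,
          abs_sub_comm (G n x) (G n y)]⟩
  have hbdd : ∀ x, ∃ C, ∀ n, |G n x| ≤ C :=
    eq_univ_iff_forall.1 (hclopen.eq_univ ⟨x₀, M, hM⟩)
  have hcomp : IsCompact (closure (range G)) := by
    have : T2Space (UniformOnFun X ℝ {K | IsCompact K}) := UniformOnFun.t2Space_of_covering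
      (eq_univ_of_forall fun x => mem_sUnion_of_mem (mem_singleton x) isCompact_singleton)
    refine ArzelaAscoli.isCompact_closure_of_isClosedEmbedding
      (F := fun g : C(X, ℝ) => (g : X → ℝ)) (𝔖 := {K | IsCompact K}) (fun K hK => hK)
      ContinuousMap.isUniformEmbedding_toUniformOnFunIsCompact.isClosedEmbedding ?_ ?_
    · intro K _
      refine Equicontinuous.equicontinuousOn (fun x U hU => ?_) K
      filter_upwards [hG x U hU] with y hy
      rintro ⟨_, n, rfl⟩
      exact hy n
    · intro K _ x _
      obtain ⟨C, hC⟩ := hbdd x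
      refine ⟨Icc (-C) C, isCompact_Icc, ?_⟩
      rintro _ ⟨n, rfl⟩
      exact abs_le.1 (hC n)
  obtain ⟨g, -, φ, hφ, h⟩ := hcomp.tendsto_subseq fun n => subset_closure (mem_range_self n)
  exact ⟨g, φ, hφ, h⟩

theorem ContinuousOn.continuous_slice {T t : ℝ} {f : ℝ → ℝ → ℝ}
    (hf : ContinuousOn (fun p : ℝ × ℝ => f p.1 p.2) (Icc (0 : ℝ) T ×ˢ (univ : Set ℝ)))
    (ht : t ∈ Icc (0 : ℝ) T) : Continuous (f t) :=
  hf.comp_continuous (f := fun x => (t, x)) (by fun_prop) fun _ => ⟨ht, mem_univ _⟩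

/-- Uniform convergence together with uniform smallness of the seminorms near `0` gives
convergence in `X^β_T`. -/
theorem convX_of_uniform {β T : ℝ} (hβ : 0 < β) {g : ℕ → ℝ → ℝ → ℝ} {f : ℝ → ℝ → ℝ}
    (hg : ∀ n, ∀ t ∈ Icc (0 : ℝ) T, Measurable (g n t))
    (hf : ∀ t ∈ Icc (0 : ℝ) T, Measurable (f t))
    (hnear : ∀ R > (0 : ℝ), ∀ ε > (0 : ℝ), ∃ δ > (0 : ℝ), ∀ n, ∀ t ∈ Icc (0 : ℝ) T,
      ∀ x ∈ Icc (-R) R, NN β δ (g n) t x ≤ ENNReal.ofReal ε)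
    (hunif : ∀ R > (0 : ℝ), ∀ ε > (0 : ℝ), ∃ N : ℕ, ∀ n ≥ N, ∀ t ∈ Icc (0 : ℝ) T,
      ∀ x ∈ Icc (-R) R, |g n t x - f t x| ≤ ε) :
    convX β T g f := by
  intro R hR ε hε
  obtain ⟨δ, hδ, hgδ⟩ := hnear R hR (ε / 4) (by positivity)
  have hlim : ∀ t ∈ Icc (0 : ℝ) T, ∀ y, Tendsto (fun n => g n t y) atTop (𝓝 (f t y)) := by
    intro t ht y
    refine Metric.tendsto_atTop.2 fun e he => ?_
    obtain ⟨N, hN⟩ := hunif (|y| + 1) (by positivity) (e / 2) (by positivity)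
    refine ⟨N, fun n hn => ?_⟩
    have := hN n hn t ht y (abs_le.1 (by linarith))
    rw [Real.dist_eq]
    linarith
  have hfδ : ∀ t ∈ Icc (0 : ℝ) T, ∀ x ∈ Icc (-R) R, NN β δ f t x ≤ ENNReal.ofReal (ε / 4) :=
    fun t ht x hx => NN_le_of_tendsto (fun n => hg n t ht) (hlim t ht) fun n => hgδ n t ht x hx
  set c := δ ^ (-1 - 2 * β) with hc
  have hc0 : 0 < c := by positivity
  set η := ε / (6 * (c + 1)) with hη
  have hη0 : 0 < η := by positivity
  have hηc : 8 * η ^ 2 * c ≤ (ε / 2) ^ 2 := by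
    rw [hη, div_pow, div_pow, mul_div_assoc', div_mul_eq_mul_div, div_le_div_iff₀ (by positivity)
      (by positivity)]
    nlinarith [mul_nonneg (sq_nonneg ε) (show 0 ≤ 36 * (c + 1) ^ 2 - 32 * c by nlinarith)]
  obtain ⟨N₁, hN₁⟩ := hunif (R + 1) (by positivity) η hη0
  obtain ⟨N₂, hN₂⟩ := hunif R hR ε hε
  refine ⟨max N₁ N₂, fun n hn t ht x hx =>
    ⟨hN₂ n (le_of_max_le_right hn) t ht x hx, ?_⟩⟩
  calc NN β 1 (fun t' x' => g n t' x' - f t' x') t x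
      ≤ NN β δ (fun t' x' => g n t' x' - f t' x') t x
        + ENNReal.ofReal (8 * η ^ 2 * c) ^ (1 / 2 : ℝ) :=
        NN_one_le hβ hδ fun y hy => hN₁ n (le_of_max_le_left hn) t ht y
          ⟨by linarith [hx.1, hy.1], by linarith [hx.2, hy.2]⟩
    _ ≤ (ENNReal.ofReal (ε / 4) + ENNReal.ofReal (ε / 4)) + ENNReal.ofReal (ε / 2) := by
        gcongr
        · exact (NN_sub_le (hg n t ht) (hf t ht) x).trans
            (add_le_add (hgδ n t ht x hx) (hfδ t ht x hx))
        · rw [one_div, ENNReal.rpow_inv_le_iff (by norm_num),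
            ENNReal.ofReal_rpow_of_nonneg (by positivity) (by norm_num), Real.rpow_two]
          exact ENNReal.ofReal_le_ofReal hηc
    _ = ENNReal.ofReal ε := by
        rw [← ENNReal.ofReal_add (by positivity) (by positivity),
          ← ENNReal.ofReal_add (by positivity) (by positivity)]
        congr 1; ring

/-- `X^β_T` is closed under convergence in `X^β_T`. -/
theorem memX_of_convX {β T : ℝ} {g : ℕ → ℝ → ℝ → ℝ} {f : ℝ → ℝ → ℝ} (hg : ∀ n, memX β T (g n))
    (hf : ContinuousOn (fun p : ℝ × ℝ => f p.1 p.2) (Icc (0 : ℝ) T ×ˢ (univ : Set ℝ)))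
    (hconv : convX β T g f) : memX β T f := by
  have hgm : ∀ n, ∀ t ∈ Icc (0 : ℝ) T, Measurable (g n t) := fun n t ht =>
    ((hg n).1.continuous_slice ht).measurable
  have hfm : ∀ t ∈ Icc (0 : ℝ) T, Measurable (f t) := fun t ht =>
    (hf.continuous_slice ht).measurable
  have hle : ∀ n, ∀ t ∈ Icc (0 : ℝ) T, ∀ x, NN β 1 f t x ≤ NN β 1 (g n) t x
      + NN β 1 (fun t' x' => g n t' x' - f t' x') t x := fun n t ht x => by
    have h := NN_sub_le (β := β) (δ := 1) (g := fun t' x' => g n t' x' - f t' x') (hgm n t ht)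
      ((hgm n t ht).sub (hfm t ht)) x
    simpa only [sub_sub_cancel] using h
  have hge : ∀ n, ∀ t ∈ Icc (0 : ℝ) T, ∀ x, NN β 1 (g n) t x ≤ NN β 1 f t x
      + NN β 1 (fun t' x' => g n t' x' - f t' x') t x := fun n t ht x => by
    have h := NN_add_le (β := β) (δ := 1) (g := fun t' x' => g n t' x' - f t' x') (hfm t ht)
      ((hgm n t ht).sub (hfm t ht)) x
    simpa only [add_sub_cancel] using h
  have hfin : ∀ t ∈ Icc (0 : ℝ) T, ∀ x, NN β 1 f t x ≠ ⊤ := fun t ht x => by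
    obtain ⟨N, hN⟩ := hconv (|x| + 1) (by positivity) 1 one_pos
    refine ne_top_of_le_ne_top ?_ (hle N t ht x)
    exact ENNReal.add_ne_top.2 ⟨(hg N).2.1 t ht x, ne_top_of_le_ne_top ENNReal.ofReal_ne_top
      (hN N le_rfl t ht x (abs_le.1 (by linarith))).2⟩
  have htoReal : ∀ {a b : ℝ≥0∞} {e : ℝ}, 0 ≤ e → b ≠ ⊤ → a ≤ b + ENNReal.ofReal e →
      a.toReal ≤ b.toReal + e := fun {a b e} he hb h => by
    rw [← ENNReal.toReal_ofReal he, ← ENNReal.toReal_add hb ENNReal.ofReal_ne_top]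
    exact ENNReal.toReal_mono (by simp [hb]) h
  refine ⟨hf, hfin, ?_, fun R hR => ENNReal.tendsto_nhds_zero.2 fun ε hε => ?_⟩
  · refine TendstoLocallyUniformlyOn.continuousOn
      (F := fun n (p : ℝ × ℝ) => (NN β 1 (g n) p.1 p.2).toReal) (p := atTop) ?_
      (Frequently.of_forall fun n => (hg n).2.2.1)
    refine Metric.tendstoLocallyUniformlyOn_iff.2 fun ε hε p hp => ?_
    obtain ⟨N, hN⟩ := hconv (|p.2| + 1) (by positivity) (ε / 2) (by positivity)
    have hnhds : ∀ᶠ q : ℝ × ℝ in 𝓝 p, |q.2| < |p.2| + 1 :=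
      (continuous_snd.abs.tendsto p).eventually_lt_const (lt_add_one _)
    refine ⟨{q | |q.2| < |p.2| + 1} ∩ (Icc (0 : ℝ) T ×ˢ univ),
      inter_mem (mem_nhdsWithin_of_mem_nhds hnhds) self_mem_nhdsWithin, ?_⟩
    filter_upwards [eventually_ge_atTop N] with n hn q hq
    have ht := hq.2.1
    have hd := (hN n hn q.1 ht q.2 (abs_le.1 (le_of_lt hq.1))).2
    have h1 := htoReal (by positivity) ((hg n).2.1 q.1 ht q.2)
      ((hle n q.1 ht q.2).trans (add_le_add_right hd _))
    have h2 := htoReal (by positivity) (hfin q.1 ht q.2)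
      ((hge n q.1 ht q.2).trans (add_le_add_right hd _))
    rw [Real.dist_eq, abs_lt]
    constructor <;> linarith
  · obtain ⟨e, he, heε⟩ : ∃ e : ℝ, 0 < e ∧
        ENNReal.ofReal e + ENNReal.ofReal e + ENNReal.ofReal e ≤ ε := by
      rcases eq_or_ne ε ⊤ with rfl | htop
      · exact ⟨1, one_pos, le_top⟩
      have := ENNReal.toReal_pos hε.ne' htop
      refine ⟨ε.toReal / 3, by positivity, ?_⟩
      rw [← ENNReal.ofReal_add (by positivity) (by positivity),
        ← ENNReal.ofReal_add (by positivity) (by positivity)]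
      exact (ENNReal.ofReal_le_iff_le_toReal htop).2 (by linarith)
    obtain ⟨N, hN⟩ := hconv (R + 1) (by positivity) e he
    have hh : ∀ᶠ h : ℝ in 𝓝 0, |h| < 1 :=
      (continuous_abs.tendsto' (0 : ℝ) 0 abs_zero).eventually_lt_const one_pos
    filter_upwards [hh, ENNReal.tendsto_nhds_zero.1 ((hg N).2.2.2 R hR) (ENNReal.ofReal e)
      (ENNReal.ofReal_pos.2 he)] with h hh1 hsup
    refine iSup_le fun ⟨t, ht⟩ => iSup_le fun ⟨x, hx⟩ => le_trans ?_ heε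
    have hgN : NN β 1 (fun t' x' => g N t' (x' - h) - g N t' x') t x ≤ ENNReal.ofReal e :=
      (le_iSup₂ (f := fun (t : Icc (0 : ℝ) T) (x : Icc (-R) R) =>
        NN β 1 (fun t' x' => g N t' (x' - h) - g N t' x') t.1 x.1) ⟨t, ht⟩ ⟨x, hx⟩).trans hsup
    obtain ⟨hh2, hh3⟩ := abs_lt.1 hh1
    have hd := (hN N le_rfl t ht x ⟨by linarith [hx.1], by linarith [hx.2]⟩).2
    have hdh := (hN N le_rfl t ht (x - h) ⟨by linarith [hx.1], by linarith [hx.2]⟩).2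
    rw [← NN_comp_sub] at hdh
    have hdm : Measurable fun x' => g N t x' - f t x' := (hgm N t ht).sub (hfm t ht)
    have hshift : ∀ u : ℝ → ℝ, Measurable u → Measurable fun x' => u (x' - h) := fun u hu =>
      hu.comp (measurable_sub_const h)
    calc NN β 1 (fun t' x' => f t' (x' - h) - f t' x') t x
        = NN β 1 (fun t' x' => ((g N t' (x' - h) - g N t' x') + (g N t' x' - f t' x'))
            - (g N t' (x' - h) - f t' (x' - h))) t x := by
          refine NN_congr (funext fun x' => ?_) x
          ring
      _ ≤ NN β 1 (fun t' x' => (g N t' (x' - h) - g N t' x') + (g N t' x' - f t' x')) t x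
          + NN β 1 (fun t' x' => g N t' (x' - h) - f t' (x' - h)) t x :=
          NN_sub_le (((hshift _ (hgm N t ht)).sub (hgm N t ht)).add hdm) (hshift _ hdm) x
      _ ≤ _ := by
          gcongr
          exact (NN_add_le ((hshift _ (hgm N t ht)).sub (hgm N t ht)) hdm x).trans
            (add_le_add hgN hd)

/-- Compactness criterion in `X^β_T`: a family `𝔉 ⊆ X^β_T` satisfying
[A1] `sup_{f∈𝔉} |f(0,0)| < ∞`,
[A2] equicontinuity in time of `{f(·,x) : f ∈ 𝔉}` for each fixed `x`, and
[A3] `lim_{δ↓0} sup_{f∈𝔉} sup_{t∈[0,T], x∈[-R,R]} ∫_{|y|≤δ} |f(t,x+y)-f(t,x)|² |y|^{-1-2β} dy = 0`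
for every `R > 0`, is relatively compact: every sequence in `𝔉` has a subsequence
converging in `X^β_T` to an element of `X^β_T`. -/
theorem stmt_10 (β T : ℝ) (hβ : β ∈ Set.Ioo (0:ℝ) 1) (hT : 0 < T)
    (F : Set (ℝ → ℝ → ℝ)) (hF : ∀ f ∈ F, memX β T f)
    (hA1 : ∃ M : ℝ, ∀ f ∈ F, |f 0 0| ≤ M)
    (hA2 : ∀ x : ℝ, ∀ t ∈ Set.Icc (0:ℝ) T, ∀ ε > (0:ℝ), ∃ δ > (0:ℝ),
      ∀ f ∈ F, ∀ s ∈ Set.Icc (0:ℝ) T, |s - t| < δ → |f s x - f t x| < ε)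
    (hA3 : ∀ R > (0:ℝ), Filter.Tendsto
      (fun δ : ℝ => ⨆ (f : F) (t : Set.Icc (0:ℝ) T) (x : Set.Icc (-R) R),
        ∫⁻ y in Set.Icc (-δ) δ,
          ENNReal.ofReal (|f.1 t.1 (x.1 + y) - f.1 t.1 x.1| ^ 2 * |y| ^ (-1 - 2 * β)))
      (nhdsWithin 0 (Set.Ioi 0)) (nhds (0 : ℝ≥0∞))) :
    ∀ g : ℕ → ℝ → ℝ → ℝ, (∀ n, g n ∈ F) →
      ∃ (f : ℝ → ℝ → ℝ) (φ : ℕ → ℕ), StrictMono φ ∧ memX β T f ∧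
        convX β T (fun k => g (φ k)) f := by
  have hsmall : ∀ R > (0 : ℝ), ∀ ε : ℝ≥0∞, 0 < ε → ∃ δ > (0 : ℝ), ∀ f ∈ F, ∀ t ∈ Icc (0 : ℝ) T,
      ∀ x ∈ Icc (-R) R, ∫⁻ y in Icc (-δ) δ,
        ENNReal.ofReal (|f t (x + y) - f t x| ^ 2 * |y| ^ (-1 - 2 * β)) ≤ ε := by
    intro R hR ε hε
    obtain ⟨δ, hδ, hδ0⟩ := ((ENNReal.tendsto_nhds_zero.1 (hA3 R hR) ε hε).and
      self_mem_nhdsWithin).exists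
    refine ⟨δ, hδ0, fun f hf t ht x hx => ?_⟩
    exact (iSup_le_iff.1 (iSup_le_iff.1 (iSup_le_iff.1 hδ ⟨f, hf⟩) ⟨t, ht⟩)) ⟨x, hx⟩
  intro g hg
  obtain ⟨M, hM⟩ := hA1
  have hgX : ∀ n, memX β T (g n) := fun n => hF _ (hg n)
  have hgm : ∀ n, ∀ t ∈ Icc (0 : ℝ) T, Measurable (g n t) := fun n t ht =>
    ((hgX n).1.continuous_slice ht).measurable
  let G : ℕ → C(Icc (0 : ℝ) T × ℝ, ℝ) := fun n => ⟨fun p => g n p.1 p.2,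
    (hgX n).1.comp_continuous (f := fun p : Icc (0 : ℝ) T × ℝ => (p.1.1, p.2)) (by fun_prop)
      fun p => ⟨p.1.2, mem_univ _⟩⟩
  have hequi : Equicontinuous fun n => (G n : Icc (0 : ℝ) T × ℝ → ℝ) := by
    rintro ⟨⟨t, ht⟩, x⟩
    refine Metric.equicontinuousAt_iff_right.2 fun ε hε => ?_
    obtain ⟨δ, hδ, hK⟩ := hsmall (|x| + 1) (by positivity) 1 one_pos
    obtain ⟨ρ, hρ, htime⟩ := hA2 x t ht (ε / 2) (by positivity)
    have hlim : Tendsto (fun q : Icc (0 : ℝ) T × ℝ => |q.2 - x|) (𝓝 (⟨t, ht⟩, x)) (𝓝 0) :=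
      Continuous.tendsto' (by fun_prop) _ _ (by simp)
    have hlim' : Tendsto (fun q : Icc (0 : ℝ) T × ℝ => 2 * |q.2 - x| ^ β)
        (𝓝 (⟨t, ht⟩, x)) (𝓝 0) := by
      simpa [Real.zero_rpow hβ.1.ne'] using
        (hlim.rpow_const (Or.inr hβ.1.le)).const_mul 2
    have hlimt : Tendsto (fun q : Icc (0 : ℝ) T × ℝ => |q.1.1 - t|) (𝓝 (⟨t, ht⟩, x)) (𝓝 0) :=
      Continuous.tendsto' (by fun_prop) _ _ (by simp)
    filter_upwards [hlim.eventually_lt_const hδ, hlim.eventually_lt_const one_pos,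
      hlim'.eventually_lt_const (show 0 < ε / 2 by positivity), hlimt.eventually_lt_const hρ]
      with q h1 h2 h3 h4 n
    have hq : |q.2| ≤ |x| + 1 := by linarith [abs_sub_abs_le_abs_sub q.2 x]
    have hspace := abs_sub_le_two_mul_rpow hβ.1 h1.le (hgm n q.1 q.1.2)
      (hK _ (hg n) q.1 q.1.2 x (abs_le.1 (by linarith)))
      (hK _ (hg n) q.1 q.1.2 q.2 (abs_le.1 hq))
    have ht' := htime _ (hg n) q.1 q.1.2 h4
    rw [dist_comm, Real.dist_eq]
    change |g n q.1 q.2 - g n t x| < ε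
    linarith [abs_sub_le (g n q.1 q.2) (g n q.1 x) (g n t x)]
  have : PreconnectedSpace (Icc (0 : ℝ) T) := Subtype.preconnectedSpace isPreconnected_Icc
  obtain ⟨G', φ, hφ, hlim⟩ := exists_subseq_tendsto_of_equicontinuous G hequi
    (⟨0, left_mem_Icc.2 hT.le⟩, 0) M fun n => hM _ (hg n)
  have hfc : Continuous fun p : ℝ × ℝ => G' (projIcc 0 T hT.le p.1, p.2) :=
    G'.continuous.comp ((continuous_projIcc.comp continuous_fst).prodMk continuous_snd)
  have hconv : convX β T (fun k => g (φ k)) fun t x => G' (projIcc 0 T hT.le t, x) := by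
    refine convX_of_uniform hβ.1 (fun n => hgm (φ n)) (fun t _ => ?_) (fun R hR ε hε => ?_)
      fun R hR ε hε => ?_
    · exact (hfc.comp (Continuous.prodMk_right t)).measurable
    · obtain ⟨δ, hδ, h⟩ := hsmall R hR (ENNReal.ofReal ε ^ (2 : ℝ))
        (ENNReal.rpow_pos (ENNReal.ofReal_pos.2 hε) ENNReal.ofReal_ne_top)
      refine ⟨δ, hδ, fun n t ht x hx => ?_⟩
      rw [NN, one_div, ENNReal.rpow_inv_le_iff (by norm_num)]
      exact h _ (hg _) t ht x hx
    · have h := Metric.tendstoUniformlyOn_iff.1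
        (ContinuousMap.tendsto_iff_forall_isCompact_tendstoUniformlyOn.1 hlim
          (univ ×ˢ Icc (-R) R) (isCompact_univ.prod isCompact_Icc)) ε hε
      obtain ⟨N, hN⟩ := eventually_atTop.1 h
      refine ⟨N, fun n hn t ht x hx => ?_⟩
      have h' := hN n hn (⟨t, ht⟩, x) ⟨mem_univ _, hx⟩
      rw [dist_comm, Real.dist_eq] at h'
      simp only [projIcc_of_mem hT.le ht]
      exact h'.le
  exact ⟨_, φ, hφ, memX_of_convX (fun n => hgX (φ n)) hfc.continuousOn hconv, hconv⟩
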